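/- In the permutation-and-pointer construction along a run (see context): (i) the pair (π(m), h(m)) separates I for infinitely many m; and (ii) every nonempty set Y ⊆ Γ such that (π(m), h(m)) separates Y for infinitely many m satisfies Y ⊆ I. -/

import Mathlib

/-- `infSet ρ`: the set of states occurring at infinitely many positions of `ρ`. -/
def infSet {Q : Type*} (ρ : ℕ → Q) : Set Q :=
  {q | ∃ᶠ n in Filter.atTop, ρ n = q}

/-- `IsPushLeft π X π'` says that `π' = π ⟪ X`: the permutation `π'` is obtained
from `π` by pushing the elements of `X` all the way to the left (keeping the relative
order of elements inside `X`, and of elements outside `X`). -/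
def IsPushLeft {Γ : Type*} {k : ℕ} (π : Fin k ≃ Γ) (X : Set Γ) (π' : Fin k ≃ Γ) : Prop :=
  (∀ x ∈ X, ∀ y ∉ X, π'.symm x < π'.symm y) ∧
  (∀ x y : Γ, ((x ∈ X ∧ y ∈ X) ∨ (x ∉ X ∧ y ∉ X)) →
    (π'.symm x < π'.symm y ↔ π.symm x < π.symm y))

/-- `IsMaxPos π X h` says that `h = maxPos(X, π)`: `h` is the largest position in `π`
of an element of `X`. -/
def IsMaxPos {Γ : Type*} {k : ℕ} (π : Fin k ≃ Γ) (X : Set Γ) (h : Fin k) : Prop :=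
  π h ∈ X ∧ ∀ i : Fin k, π i ∈ X → i ≤ h

/-- `π` displays the nonempty set `X` iff `X` is exactly the set of labels at
positions `0,…,|X|−1` of `π`. -/
def Displays {Γ : Type*} {k : ℕ} (π : Fin k ≃ Γ) (X : Set Γ) : Prop :=
  ∀ a : Γ, a ∈ X ↔ ((π.symm a : ℕ) < X.ncard)

/-- `(π, h)` separates `X` iff `π` displays `X` and `h = |X| − 1`. -/
def Separates {Γ : Type*} {k : ℕ} (π : Fin k ≃ Γ) (h : Fin k) (X : Set Γ) : Prop :=
  Displays π X ∧ (h : ℕ) = X.ncard - 1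

open Filter

/-- A permutation displays every set whose elements precede all non-elements. -/
lemma displays_of_forall_lt {Γ : Type*} {k : ℕ} {π : Fin k ≃ Γ} {X : Set Γ}
    (hX : ∀ x ∈ X, ∀ y ∉ X, π.symm x < π.symm y) : Displays π X := by
  classical
  have hcard : X.ncard = (π ⁻¹' X).toFinset.card := by
    rw [← Set.ncard_eq_toFinset_card', ← Equiv.image_symm_eq_preimage,
      Set.ncard_image_of_injective _ π.symm.injective]
  intro a
  rw [hcard]
  constructor
  · intro ha
    have hsub : Finset.Iic (π.symm a) ⊆ (π ⁻¹' X).toFinset := by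
      intro i hi
      simp only [Finset.mem_Iic, Set.mem_toFinset, Set.mem_preimage] at hi ⊢
      by_contra hiX
      have hlt := hX a ha _ hiX
      rw [Equiv.symm_apply_apply] at hlt
      exact absurd hi (not_le.2 hlt)
    have := Finset.card_le_card hsub
    rw [Fin.card_Iic] at this
    omega
  · intro hlt
    by_contra ha
    have hsub : (π ⁻¹' X).toFinset ⊆ Finset.Iio (π.symm a) := by
      intro i hi
      simp only [Finset.mem_Iio, Set.mem_toFinset, Set.mem_preimage] at hi ⊢
      simpa using hX _ hi a ha
    have := Finset.card_le_card hsub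
    rw [Fin.card_Iio] at this
    omega

/-- Pushing left preserves that `x` precedes `y`, as long as `y` itself is not pushed. -/
lemma IsPushLeft.lt_of_notMem {Γ : Type*} {k : ℕ} {π π' : Fin k ≃ Γ} {X : Set Γ}
    (hπ : IsPushLeft π X π') {x y : Γ} (hy : y ∉ X) (hxy : π.symm x < π.symm y) :
    π'.symm x < π'.symm y := by
  by_cases hx : x ∈ X
  · exact hπ.1 x hx y hy
  · exact (hπ.2 x y (Or.inr ⟨hx, hy⟩)).2 hxy

/-- Along iterated pushes, `x` keeps preceding `y` until `y` is pushed. -/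
lemma symm_lt_symm_of_forall_notMem {Γ : Type*} {k : ℕ} {π : ℕ → (Fin k ≃ Γ)} {X : ℕ → Set Γ}
    (hπ : ∀ n, IsPushLeft (π n) (X n) (π (n + 1))) {x y : Γ} {m n : ℕ} (hmn : m ≤ n)
    (hy : ∀ i, m ≤ i → i < n → y ∉ X i) (hxy : (π m).symm x < (π m).symm y) :
    (π n).symm x < (π n).symm y := by
  induction n, hmn using Nat.le_induction with
  | base => exact hxy
  | succ n hmn ih =>
    exact (hπ n).lt_of_notMem (hy n hmn n.lt_succ_self)
      (ih fun i hi hin => hy i hi (hin.trans n.lt_succ_self))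

/-- A sequence of subsets of a finite type is eventually contained in its limit superior. -/
lemma eventually_subset_setOf_frequently {Γ : Type*} [Finite Γ] (X : ℕ → Set Γ) :
    ∀ᶠ n in atTop, X n ⊆ {a | ∃ᶠ n in atTop, a ∈ X n} := by
  have : ∀ᶠ n in atTop, ∀ a, a ∈ X n → ∃ᶠ n in atTop, a ∈ X n := by
    refine eventually_all.2 fun a => ?_
    by_cases ha : ∃ᶠ n in atTop, a ∈ X n
    · exact Eventually.of_forall fun _ _ => ha
    · exact (not_frequently.1 ha).mono fun _ hn h => absurd h hn
  exact this

/-- Under iterated pushes, the set of labels pushed infinitely often is eventually displayed. -/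
lemma eventually_displays_setOf_frequently {Γ : Type*} [Finite Γ] {k : ℕ}
    {π : ℕ → (Fin k ≃ Γ)} {X : ℕ → Set Γ} (hπ : ∀ n, IsPushLeft (π n) (X n) (π (n + 1))) :
    ∀ᶠ n in atTop, Displays (π n) {a | ∃ᶠ n in atTop, a ∈ X n} := by
  obtain ⟨N, hN⟩ := eventually_atTop.1 (eventually_subset_setOf_frequently X)
  have hlt : ∀ᶠ n in atTop, ∀ x y, (∃ᶠ n in atTop, x ∈ X n) → (¬ ∃ᶠ n in atTop, y ∈ X n) →
      (π n).symm x < (π n).symm y := by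
    refine eventually_all.2 fun x => eventually_all.2 fun y => ?_
    by_cases hx : ∃ᶠ n in atTop, x ∈ X n
    · obtain ⟨m, hNm, hxm⟩ := frequently_atTop.1 hx N
      filter_upwards [eventually_ge_atTop (m + 1)] with n hn _ hy
      exact symm_lt_symm_of_forall_notMem hπ hn
        (fun i hi _ hyi => hy (hN i (by omega) hyi))
        ((hπ m).1 x hxm y fun hym => hy (hN m hNm hym))
    · exact Eventually.of_forall fun _ h => absurd h hx
  exact hlt.mono fun n hn => displays_of_forall_lt fun x hx y hy => hn x y hx hy

theorem stmt_13 {Q Γ : Type*} [Finite Q] [Fintype Γ] {k : ℕ}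
    (hcard : Fintype.card Γ = k) (hk : 1 ≤ k)
    (lab : Q → Set Γ) (hlab : ∀ q : Q, (lab q).Nonempty)
    (ρ : ℕ → Q)
    (π : ℕ → (Fin k ≃ Γ)) (h : ℕ → Fin k)
    (hπ : ∀ n : ℕ, IsPushLeft (π n) (lab (ρ n)) (π (n + 1)))
    (hh0 : (h 0 : ℕ) = 0)
    (hh : ∀ n : ℕ, IsMaxPos (π n) (lab (ρ n)) (h (n + 1))) :
    (∃ᶠ m in Filter.atTop,
      Separates (π m) (h m) {a : Γ | ∃ᶠ n in Filter.atTop, a ∈ lab (ρ n)}) ∧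
    (∀ Y : Set Γ, Y.Nonempty → (∃ᶠ m in Filter.atTop, Separates (π m) (h m) Y) →
      Y ⊆ {a : Γ | ∃ᶠ n in Filter.atTop, a ∈ lab (ρ n)}) := by
  classical
  set I : Set Γ := {a : Γ | ∃ᶠ n in Filter.atTop, a ∈ lab (ρ n)} with hI
  obtain ⟨N, hN⟩ := eventually_atTop.1
    ((eventually_subset_setOf_frequently fun n => lab (ρ n)).and
      (eventually_displays_setOf_frequently (X := fun n => lab (ρ n)) hπ))
  have hsub : ∀ n, N ≤ n → lab (ρ n) ⊆ I := fun n hn => (hN n hn).1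
  have hdisp : ∀ n, N ≤ n → Displays (π n) I := fun n hn => (hN n hn).2
  constructor
  · have hIne : I.Nonempty := (hlab (ρ N)).mono (hsub N le_rfl)
    have hIpos : 0 < I.ncard := (Set.ncard_pos I.toFinite).2 hIne
    have hIk : I.ncard ≤ k := by
      rw [← hcard, ← Nat.card_eq_fintype_card]
      exact Set.ncard_le_card I
    let p : Fin k := ⟨I.ncard - 1, by omega⟩
    have hp : (p : ℕ) = I.ncard - 1 := rfl
    refine frequently_atTop.2 fun M₀ => ?_
    let M := max M₀ N
    have hNM : N ≤ M := le_max_right _ _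
    let c := π M p
    have hcI : c ∈ I := (hdisp M hNM c).2 (by simp only [c, Equiv.symm_apply_apply]; omega)
    have hex : ∃ n, M ≤ n ∧ c ∈ lab (ρ n) := frequently_atTop.1 hcI M
    obtain ⟨hMn, hcn⟩ := Nat.find_spec hex
    set n := Nat.find hex
    have hNn : N ≤ n := hNM.trans hMn
    have hlast : ∀ x ∈ I, x ≠ c → (π n).symm x < (π n).symm c := by
      intro x hx hxc
      refine symm_lt_symm_of_forall_notMem (X := fun n => lab (ρ n)) hπ hMn
        (fun i hi hin hci => Nat.find_min hex hin ⟨hi, hci⟩) ?_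
      have hxlt := (hdisp M hNM x).1 hx
      have hne : (π M).symm x ≠ p := fun h => hxc ((Equiv.symm_apply_eq _).1 h)
      have hne' := Fin.val_ne_of_ne hne
      simp only [c, Equiv.symm_apply_apply, Fin.lt_def]
      omega
    have hcp : (π n).symm c = p := by
      by_contra hne
      have hpI : π n p ∈ I := (hdisp n hNn _).2 (by rw [Equiv.symm_apply_apply]; omega)
      have hlt := hlast _ hpI fun h => hne (by rw [← h, Equiv.symm_apply_apply])
      have hclt := (hdisp n hNn c).1 hcI
      rw [Equiv.symm_apply_apply, Fin.lt_def] at hlt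
      omega
    refine ⟨n + 1, by omega, hdisp _ (by omega), ?_⟩
    have hle : p ≤ h (n + 1) := (hh n).2 p (by rwa [← hcp, Equiv.apply_symm_apply])
    have hlt := (hdisp n hNn _).1 (hsub n hNn (hh n).1)
    rw [Equiv.symm_apply_apply] at hlt
    rw [Fin.le_def] at hle
    omega
  · intro Y hY hsep a ha
    obtain ⟨m, hm, hYdisp, hYh⟩ := frequently_atTop.1 hsep (N + 1)
    obtain ⟨n, rfl⟩ : ∃ n, m = n + 1 := ⟨m - 1, by omega⟩
    have hNn : N ≤ n := by omega
    have hlt := (hdisp n hNn _).1 (hsub n hNn (hh n).1)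
    rw [Equiv.symm_apply_apply] at hlt
    have halt := (hYdisp a).1 ha
    exact (hdisp (n + 1) (by omega) a).2 (by omega)
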